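/- arXiv:2312.12886 — 2 statements merged into one kernel-verified Lean document; each statement's English description precedes it below -/
import Mathlib

section
/- (Intermediate integration-by-parts identity in the proof of Theorem 4.4.) Let T > 0, η > 0, let V ∈ C¹(ℝ) be nondecreasing, and let q ∈ W^{1,∞}(Ω_T) be a strong solution of the nonlocal conservation law ∂_t q + ∂_x(V(W)q) = 0 with exponential kernel γ_η, where W := W[q,γ_η]. Set G(y) := ∫_0^y sV(s) ds. Then for every φ ∈ C¹_c([0,T)×ℝ): ∬_{Ω_T} ∂_x q·(V(|q|) − V(W))·q·φ dx dt = −∬_{Ω_T}(G(|q|) − G(W))∂_xφ dx dt + (1/2)∬_{Ω_T}(q² − W²)V(W)∂_xφ dx dt + η∬_{Ω_T} V'(W)(∂_xW)²(W + (η/2)∂_xW)φ dx dt, where all partial derivatives of q are understood almost everywhere; in particular, since W ≥ 0, W + η∂_xW = |q| ≥ 0 and V' ≥ 0, the last term is nonnegative whenever φ ≥ 0. -/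
open MeasureTheory Set Filter Function

noncomputable section

/-- The nonlocal term `W[q,γ](t,x) = ∫_{-∞}^x γ(y-x) |q(t,y)| dy`. -/
def nonlocalTerm (γ : ℝ → ℝ) (q : ℝ → ℝ → ℝ) (t x : ℝ) : ℝ :=
  ∫ y in Iic x, γ (y - x) * |q t y|

/-- The exponential kernel `γ_η(x) = exp(x/η)/η`. -/
def expKernel (η : ℝ) (x : ℝ) : ℝ := Real.exp (x / η) / η

/-- An admissible kernel: nonnegative, nondecreasing, convex, of bounded variation,
and of unit mass on `(-∞, 0]`. -/
structure AdmissibleKernel (γ : ℝ → ℝ) : Prop where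
  nonneg : ∀ x ≤ (0:ℝ), 0 ≤ γ x
  mono : MonotoneOn γ (Iic (0:ℝ))
  convex : ConvexOn ℝ (Iic (0:ℝ)) γ
  bv : BoundedVariationOn γ (Iic (0:ℝ))
  mass : (∫ x in Iic (0:ℝ), γ x) = 1

/-- A test function in `C¹_c([0,T) × ℝ)`. -/
structure IsTestFun (T : ℝ) (φ : ℝ → ℝ → ℝ) : Prop where
  smooth : ContDiff ℝ 1 (uncurry φ)
  compSupp : HasCompactSupport (uncurry φ)
  vanish : ∀ t x : ℝ, T ≤ t → φ t x = 0

/-- Membership in `C([0,T]; L¹_loc(ℝ)) ∩ L^∞(Ω_T)`. -/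
structure InSolutionClass (T : ℝ) (q : ℝ → ℝ → ℝ) : Prop where
  meas : Measurable (uncurry q)
  bdd : ∃ M : ℝ, ∀ t x : ℝ, |q t x| ≤ M
  timeCont : ∀ s ∈ Icc (0:ℝ) T, ∀ K : Set ℝ, IsCompact K →
    Tendsto (fun t => ∫ x in K, |q t x - q s x|) (nhdsWithin s (Icc (0:ℝ) T)) (nhds 0)

/-- Weak solution of the nonlocal conservation law
`∂ₜ q + ∂ₓ (V(W[q,γ]) q) = 0`, `q(0,·) = q₀`. -/
def IsWeakSolutionNonlocal (T : ℝ) (V γ q₀ : ℝ → ℝ) (q : ℝ → ℝ → ℝ) : Prop :=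
  ∀ φ : ℝ → ℝ → ℝ, IsTestFun T φ →
    (∫ t in Ioo (0:ℝ) T, ∫ x : ℝ, q t x *
        (deriv (fun s => φ s x) t + deriv (fun y => φ t y) x * V (nonlocalTerm γ q t x)))
      + (∫ x : ℝ, φ 0 x * q₀ x) = 0

/-- Strong solution: Lipschitz on `[0,T] × ℝ` and the PDE holds pointwise a.e. in `Ω_T`. -/
def IsStrongSolutionNonlocal (T : ℝ) (V γ q₀ : ℝ → ℝ) (q : ℝ → ℝ → ℝ) : Prop :=
  (∃ L : NNReal, LipschitzOnWith L (uncurry q) (Icc (0:ℝ) T ×ˢ (univ : Set ℝ))) ∧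
  (∀ x : ℝ, q 0 x = q₀ x) ∧
  (∀ᵐ p : ℝ × ℝ ∂(volume.restrict (Ioo (0:ℝ) T ×ˢ (univ : Set ℝ))),
    deriv (fun s => q s p.2) p.1
      + deriv (fun y => V (nonlocalTerm γ q p.1 y) * q p.1 y) p.2 = 0)

/-- The entropy functional `ℰ[φ,α,q]` (with entropy flux `β`). -/
def entropyE (T : ℝ) (q₀ : ℝ → ℝ) (α β : ℝ → ℝ) (φ : ℝ → ℝ → ℝ) (q : ℝ → ℝ → ℝ) : ℝ :=
  (∫ t in Ioo (0:ℝ) T, ∫ x : ℝ,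
      α (q t x) * deriv (fun s => φ s x) t + β (q t x) * deriv (fun y => φ t y) x)
    + ∫ x : ℝ, α (q₀ x) * φ 0 x

/-- Weak solution of the local conservation law `∂ₜ q + ∂ₓ (V(|q|) q) = 0`. -/
def IsWeakSolutionLocal (T : ℝ) (V q₀ : ℝ → ℝ) (q : ℝ → ℝ → ℝ) : Prop :=
  ∀ φ : ℝ → ℝ → ℝ, IsTestFun T φ →
    (∫ t in Ioo (0:ℝ) T, ∫ x : ℝ, q t x *
        (deriv (fun s => φ s x) t + deriv (fun y => φ t y) x * V |q t x|))
      + (∫ x : ℝ, φ 0 x * q₀ x) = 0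

/-- Entropy solution of the local conservation law. -/
def IsEntropySolutionLocal (T : ℝ) (V q₀ : ℝ → ℝ) (q : ℝ → ℝ → ℝ) : Prop :=
  ∀ α β : ℝ → ℝ, ContDiff ℝ 2 α → ConvexOn ℝ univ α → ContDiff ℝ 1 β →
    (∀ x : ℝ, deriv β x = deriv α x * deriv (fun y => y * V |y|) x) →
    ∀ φ : ℝ → ℝ → ℝ, IsTestFun T φ → (∀ t x : ℝ, 0 ≤ φ t x) →
      0 ≤ entropyE T q₀ α β φ q


/-- A locally Lipschitz function with compact support has an integrable derivative of zero integral. -/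
theorem LocallyLipschitz.integrable_deriv_and_integral_deriv_eq_zero {F : ℝ → ℝ}
    (hF : LocallyLipschitz F) (hs : HasCompactSupport F) :
    Integrable (deriv F) ∧ ∫ x, deriv F x = 0 := by
  obtain ⟨R, hR⟩ := hs.isBounded.subset_ball (0 : ℝ)
  have hR' : ∀ x, x ∉ Ioo (-R) R → F x = 0 := fun x hx => by
    by_contra h
    have := hR (subset_tsupport _ h)
    rw [Real.ball_eq_Ioo] at this
    simp at this hx
    exact absurd (hx this.1) (not_le.2 this.2)
  have hd : support (deriv F) ⊆ Ioc (-(|R| + 1)) (|R| + 1) := by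
    intro x hx
    have := hR (support_deriv_subset hx)
    rw [Real.ball_eq_Ioo] at this
    have h1 := le_abs_self R
    exact ⟨by linarith [this.1], by linarith [this.2]⟩
  have hle : -(|R| + 1) ≤ |R| + 1 := by linarith [abs_nonneg R]
  obtain ⟨K, hK⟩ := LocallyLipschitzOn.exists_lipschitzOnWith_of_compact
    (isCompact_uIcc (a := -(|R| + 1)) (b := |R| + 1)) hF.locallyLipschitzOn
  have hac := hK.absolutelyContinuousOnInterval
  constructor
  · rw [← integrableOn_iff_integrable_of_support_subset hd]
    exact (intervalIntegrable_iff_integrableOn_Ioc_of_le hle).1 hac.intervalIntegrable_deriv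
  · rw [← setIntegral_eq_integral_of_forall_compl_eq_zero
      (s := Ioc (-(|R| + 1)) (|R| + 1)) (fun x hx => by
        by_contra h; exact hx (hd h)),
      ← intervalIntegral.integral_of_le hle, hac.integral_deriv_eq_sub, hR', hR', sub_zero]
    · intro h; linarith [h.1, le_abs_self R, neg_abs_le R]
    · intro h; linarith [h.2, le_abs_self R, neg_abs_le R]

theorem integrable_mul_of_hasCompactSupport {X : Type*} [TopologicalSpace X] [MeasurableSpace X]
    [OpensMeasurableSpace X] {μ : Measure X} [IsFiniteMeasureOnCompacts μ] {g ψ : X → ℝ}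
    (hg : Continuous g) (hψ : Continuous ψ) (hs : HasCompactSupport ψ) :
    Integrable (fun x => g x * ψ x) μ :=
  (hg.mul hψ).integrable_of_hasCompactSupport hs.mul_left

section NonlocalTerm

variable {η C M : ℝ}

theorem integrableOn_exp_div_mul_linear_Iic (hη : 0 < η) (C M : ℝ) :
    IntegrableOn (fun y => Real.exp (y / η) * (C + M * |y|)) (Iic 0) := by
  have h1 : IntegrableOn (fun y => Real.exp ((2 * η)⁻¹ * y)) (Iic 0) :=
    integrableOn_exp_mul_Iic (by positivity) 0
  refine Integrable.mono' (h1.const_mul (|C| + |M| * (2 * η)))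
    (Continuous.aestronglyMeasurable (by fun_prop)) ?_
  filter_upwards [ae_restrict_mem measurableSet_Iic] with y hy
  have hy0 : y ≤ 0 := hy
  set e := Real.exp ((2 * η)⁻¹ * y) with he
  have he0 : 0 < e := Real.exp_pos _
  have h2 : Real.exp (y / η) = e * e := by
    rw [he, ← Real.exp_add]; congr 1; field_simp; ring
  have h3 : e ≤ 1 := Real.exp_le_one_iff.2 (mul_nonpos_of_nonneg_of_nonpos (by positivity) hy0)
  have h4 : |y| * e ≤ 2 * η := by
    have h5 := Real.add_one_le_exp (-((2 * η)⁻¹ * y))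
    rw [Real.exp_neg, ← he] at h5
    have h6 : -((2 * η)⁻¹ * y) * e ≤ 1 := by
      calc _ ≤ e⁻¹ * e := by gcongr; linarith
        _ = 1 := inv_mul_cancel₀ he0.ne'
    rw [abs_of_nonpos hy0]
    calc -y * e = 2 * η * (-((2 * η)⁻¹ * y) * e) := by field_simp
      _ ≤ 2 * η * 1 := by gcongr
      _ = _ := mul_one _
  rw [Real.norm_eq_abs, abs_mul, abs_of_pos (Real.exp_pos _), h2]
  calc e * e * |C + M * (|y|)| ≤ e * e * (|C| + |M| * |y|) := by
        gcongr
        exact (abs_add_le _ _).trans (by rw [abs_mul, abs_abs])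
    _ = e * (|C| * e + |M| * (|y| * e)) := by ring
    _ ≤ e * (|C| * 1 + |M| * (2 * η)) := by gcongr
    _ = _ := by ring

theorem integrableOn_exp_div_mul_abs_Iic (hη : 0 < η) {f : ℝ → ℝ} (hf : Continuous f)
    (hb : ∀ y, |f y| ≤ C + M * |y|) (x : ℝ) :
    IntegrableOn (fun y => Real.exp (y / η) * |f y|) (Iic x) := by
  have hc : Continuous (fun y => Real.exp (y / η) * |f y|) := by fun_prop
  have h0 : IntegrableOn (fun y => Real.exp (y / η) * |f y|) (Iic 0) := by
    refine Integrable.mono' (integrableOn_exp_div_mul_linear_Iic hη C M)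
      hc.aestronglyMeasurable (Eventually.of_forall fun y => ?_)
    rw [Real.norm_eq_abs, abs_mul, abs_abs, abs_of_pos (Real.exp_pos _)]
    gcongr
    exact hb y
  refine (h0.union (hc.integrableOn_Icc (a := 0) (b := x))).mono_set fun y hy => ?_
  rcases le_total y 0 with h | h
  · exact Or.inl h
  · exact Or.inr ⟨h, hy⟩

theorem nonlocalTerm_expKernel_eq (hη : 0 < η) {q : ℝ → ℝ → ℝ} {t : ℝ}
    (hc : Continuous (q t)) (hb : ∀ y, |q t y| ≤ C + M * |y|) (x : ℝ) :
    nonlocalTerm (expKernel η) q t x = Real.exp (-x / η) / η *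
      ((∫ y in Iic 0, Real.exp (y / η) * |q t y|) +
        ∫ y in (0 : ℝ)..x, Real.exp (y / η) * |q t y|) := by
  rw [← intervalIntegral.integral_Iic_sub_Iic (integrableOn_exp_div_mul_abs_Iic hη hc hb 0)
    (integrableOn_exp_div_mul_abs_Iic hη hc hb x), add_sub_cancel, ← integral_const_mul,
    nonlocalTerm]
  congr 1 with y
  rw [expKernel, sub_div, sub_eq_add_neg, Real.exp_add, neg_div]
  ring

theorem hasDerivAt_nonlocalTerm_expKernel (hη : 0 < η) {q : ℝ → ℝ → ℝ} {t : ℝ}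
    (hc : Continuous (q t)) (hb : ∀ y, |q t y| ≤ C + M * |y|) (x : ℝ) :
    HasDerivAt (nonlocalTerm (expKernel η) q t)
      ((|q t x| - nonlocalTerm (expKernel η) q t x) / η) x := by
  have hc' : Continuous (fun y => Real.exp (y / η) * |q t y|) := by fun_prop
  have h1 := (hc'.integral_hasStrictDerivAt 0 x).hasDerivAt
  have h2 : HasDerivAt (fun y => Real.exp (-y / η) / η) (Real.exp (-x / η) * (-1 / η) / η) x :=
    ((((hasDerivAt_id x).neg).div_const η).exp).div_const η
  have h3 := h2.mul (h1.const_add (∫ y in Iic 0, Real.exp (y / η) * |q t y|))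
  rw [show nonlocalTerm (expKernel η) q t = _ from
    funext (nonlocalTerm_expKernel_eq hη hc hb)]
  refine h3.congr_deriv ?_
  have h4 : Real.exp (-x / η) * Real.exp (x / η) = 1 := by
    rw [← Real.exp_add, neg_div, neg_add_cancel, Real.exp_zero]
  rw [neg_div] at h4 ⊢
  field_simp
  linear_combination (|q t x| * η) * h4

theorem continuous_nonlocalTerm_expKernel (hη : 0 < η) {q : ℝ → ℝ → ℝ}
    (hc : Continuous (uncurry q)) (hb : ∀ t y, |q t y| ≤ C + M * |y|) :
    Continuous (uncurry (nonlocalTerm (expKernel η) q)) := by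
  have hct : ∀ t, Continuous (q t) := fun t => hc.comp (Continuous.prodMk_right t)
  have h1 : Continuous fun t => ∫ y in Iic 0, Real.exp (y / η) * |q t y| := by
    refine continuous_of_dominated (bound := fun y => Real.exp (y / η) * (C + M * |y|))
      (fun t => ?_) (fun t => Eventually.of_forall fun y => ?_)
      (integrableOn_exp_div_mul_linear_Iic hη C M) (Eventually.of_forall fun y => ?_)
    · have := hct t
      exact Continuous.aestronglyMeasurable (by fun_prop)
    · rw [Real.norm_eq_abs, abs_mul, abs_abs, abs_of_pos (Real.exp_pos _)]
      gcongr
      exact hb t y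
    · have : Continuous fun t => q t y := hc.comp (Continuous.prodMk_left y)
      fun_prop
  have h2 : Continuous fun p : ℝ × ℝ => ∫ y in (0 : ℝ)..p.2, Real.exp (y / η) * |q p.1 y| := by
    refine intervalIntegral.continuous_parametric_intervalIntegral_of_continuous
      (f := fun (p : ℝ × ℝ) y => Real.exp (y / η) * |q p.1 y|) ?_ continuous_snd
    have : Continuous fun z : (ℝ × ℝ) × ℝ => q z.1.1 z.2 :=
      hc.comp ((continuous_fst.comp continuous_fst).prodMk continuous_snd)
    simp only [uncurry_def]
    fun_prop
  have h3 : uncurry (nonlocalTerm (expKernel η) q) = fun p : ℝ × ℝ => Real.exp (-p.2 / η) / η *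
      ((∫ y in Iic 0, Real.exp (y / η) * |q p.1 y|) +
        ∫ y in (0 : ℝ)..p.2, Real.exp (y / η) * |q p.1 y|) :=
    funext fun p => nonlocalTerm_expKernel_eq hη (hct p.1) (hb p.1) p.2
  rw [h3]
  have h4 := h1.comp (continuous_fst (X := ℝ) (Y := ℝ))
  exact Continuous.mul (by fun_prop) (h4.add h2)

theorem nonlocalTerm_expKernel_nonneg (hη : 0 < η) (q : ℝ → ℝ → ℝ) (t x : ℝ) :
    0 ≤ nonlocalTerm (expKernel η) q t x :=
  integral_nonneg fun _ => mul_nonneg (div_nonneg (Real.exp_pos _).le hη.le) (abs_nonneg _)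

end NonlocalTerm

section Primitive

theorem contDiff_primitive {f : ℝ → ℝ} (hf : Continuous f) :
    ContDiff ℝ 1 fun y => ∫ s in (0 : ℝ)..y, f s := by
  have h : ∀ y, HasDerivAt (fun y => ∫ s in (0 : ℝ)..y, f s) (f y) y := fun y =>
    (hf.integral_hasStrictDerivAt 0 y).hasDerivAt
  rw [contDiff_one_iff_deriv]
  exact ⟨fun y => (h y).differentiableAt, by rwa [funext fun y => (h y).deriv]⟩

theorem intervalIntegral_abs_eq (V : ℝ → ℝ) (y : ℝ) :
    ∫ s in (0 : ℝ)..|y|, s * V s = ∫ s in (0 : ℝ)..y, s * V |s| := by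
  rcases le_total 0 y with h | h
  · rw [abs_of_nonneg h]
    refine intervalIntegral.integral_congr fun s hs => ?_
    rw [uIcc_of_le h] at hs
    simp only [abs_of_nonneg hs.1]
  · have h1 := intervalIntegral.integral_comp_neg (a := 0) (b := y) fun s => s * V |s|
    have h2 := intervalIntegral.integral_symm 0 (-y) (μ := volume) (f := fun s => s * V |s|)
    rw [abs_of_nonpos h]
    have h3 : ∫ s in (0 : ℝ)..-y, s * V s = ∫ s in (0 : ℝ)..-y, s * V |s| := by
      refine intervalIntegral.integral_congr fun s hs => ?_
      rw [uIcc_of_le (by linarith)] at hs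
      simp only [abs_of_nonneg hs.1]
    rw [h3]
    simp only [abs_neg, neg_mul, intervalIntegral.integral_neg, neg_zero] at h1
    linarith

end Primitive

/-- The integration-by-parts identity in the space variable, for `w` with derivative `(|f| - w) / η`. -/
theorem integral_slice_identity {η : ℝ} (hη : 0 < η) {V : ℝ → ℝ} (hV : ContDiff ℝ 1 V)
    {G : ℝ → ℝ} (hG : ∀ y : ℝ, G y = ∫ s in (0 : ℝ)..y, s * V s) {f w φ : ℝ → ℝ} {K : NNReal}
    (hf : LipschitzWith K f) (hw : ∀ x, HasDerivAt w ((|f x| - w x) / η) x)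
    (hφ : ContDiff ℝ 1 φ) (hφc : HasCompactSupport φ) :
    (∫ x, deriv f x * (V |f x| - V (w x)) * f x * φ x) =
      -(∫ x, (G |f x| - G (w x)) * deriv φ x)
      + (1 / 2) * (∫ x, (f x ^ 2 - w x ^ 2) * V (w x) * deriv φ x)
      + η * (∫ x, deriv V (w x) * deriv w x ^ 2 * (w x + (η / 2) * deriv w x) * φ x) := by
  have hVc : Continuous V := hV.continuous
  have hG' : G = fun y => ∫ s in (0 : ℝ)..y, s * V s := funext hG
  have hG1 : ContDiff ℝ 1 G := hG' ▸ contDiff_primitive (by fun_prop)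
  have hGd : ∀ y, HasDerivAt G (y * V y) y := fun y => by
    rw [hG']
    exact (Continuous.integral_hasStrictDerivAt (f := fun s => s * V s) (by fun_prop) 0 y).hasDerivAt
  obtain ⟨H, hH⟩ : ∃ H : ℝ → ℝ, H = fun y => ∫ s in (0 : ℝ)..y, s * V |s| := ⟨_, rfl⟩
  have hGH : ∀ y, G |y| = H y := fun y => by rw [hG, hH, intervalIntegral_abs_eq]
  have hH1 : ContDiff ℝ 1 H := hH ▸ contDiff_primitive (by fun_prop)
  have hHd : ∀ y, HasDerivAt H (y * V |y|) y := fun y => by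
    rw [hH]
    exact (Continuous.integral_hasStrictDerivAt (f := fun s => s * V |s|)
      (by fun_prop) 0 y).hasDerivAt
  have hfc : Continuous f := hf.continuous
  have hwc : Continuous w := continuous_iff_continuousAt.2 fun x => (hw x).continuousAt
  have hwd : deriv w = fun x => (|f x| - w x) / η := funext fun x => (hw x).deriv
  have hw1 : ContDiff ℝ 1 w := by
    rw [contDiff_one_iff_deriv, hwd]
    exact ⟨fun x => (hw x).differentiableAt, by fun_prop⟩
  have hwdc : Continuous (deriv w) := hwd ▸ by fun_prop
  have hV'c : Continuous (deriv V) := hV.continuous_deriv le_rfl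
  have hφ'c : Continuous (deriv φ) := hφ.continuous_deriv le_rfl
  have hφ's : HasCompactSupport (deriv φ) := hφc.deriv
  let F : ℝ → ℝ := fun x =>
    (H (f x) - G (w x) - 1 / 2 * ((f x ^ 2 - w x ^ 2) * V (w x))) * φ x
  have hFl : LocallyLipschitz F := by
    have h1 : ContDiff ℝ 1 fun p : ℝ × ℝ × ℝ =>
        (H p.1 - G p.2.1 - 1 / 2 * ((p.1 ^ 2 - p.2.1 ^ 2) * V p.2.1)) * p.2.2 := by fun_prop
    have h2 : LocallyLipschitz fun x => (f x, w x, φ x) :=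
      hf.locallyLipschitz.prodMk (hw1.locallyLipschitz.prodMk hφ.locallyLipschitz)
    exact h1.locallyLipschitz.comp h2
  have hFs : HasCompactSupport F := hφc.mul_left
  obtain ⟨hFi, hF0⟩ := hFl.integrable_deriv_and_integral_deriv_eq_zero hFs
  have iA : Integrable fun x => (G |f x| - G (w x)) * deriv φ x :=
    integrable_mul_of_hasCompactSupport (by have := hG1.continuous; fun_prop) hφ'c hφ's
  have iB : Integrable fun x => (f x ^ 2 - w x ^ 2) * V (w x) * deriv φ x :=
    integrable_mul_of_hasCompactSupport (by fun_prop) hφ'c hφ's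
  have iC : Integrable fun x =>
      deriv V (w x) * deriv w x ^ 2 * (w x + (η / 2) * deriv w x) * φ x :=
    integrable_mul_of_hasCompactSupport (by fun_prop) hφ.continuous hφc
  have key : (fun x => deriv f x * (V |f x| - V (w x)) * f x * φ x) =ᵐ[volume] fun x =>
      deriv F x + (-((G |f x| - G (w x)) * deriv φ x)
        + (1 / 2) * ((f x ^ 2 - w x ^ 2) * V (w x) * deriv φ x)
        + η * (deriv V (w x) * deriv w x ^ 2 * (w x + (η / 2) * deriv w x) * φ x)) := by
    filter_upwards [hf.ae_differentiableAt] with x hx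
    have d1 := hx.hasDerivAt
    have d2 : HasDerivAt w (deriv w x) x := (hw x).differentiableAt.hasDerivAt
    have d3 : HasDerivAt φ (deriv φ x) x := (hφ.differentiable one_ne_zero x).hasDerivAt
    have d4 : HasDerivAt (fun x => V (w x)) (deriv V (w x) * deriv w x) x :=
      ((hV.differentiable one_ne_zero (w x)).hasDerivAt).comp x d2
    have d5 : HasDerivAt (fun x => H (f x)) (f x * V |f x| * deriv f x) x := (hHd (f x)).comp x d1
    have d6 : HasDerivAt (fun x => G (w x)) (w x * V (w x) * deriv w x) x := (hGd (w x)).comp x d2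
    have d7 : HasDerivAt F _ x :=
      ((d5.sub d6).sub ((((d1.pow 2).sub (d2.pow 2)).mul d4).const_mul (1 / 2))).mul d3
    rw [d7.deriv, hGH]
    have e1 : f x ^ 2 = (w x + η * deriv w x) ^ 2 := by
      rw [hwd, ← sq_abs (f x)]
      field_simp
      ring
    simp only [Pi.sub_apply, Pi.mul_apply, Pi.pow_apply, Nat.cast_ofNat]
    linear_combination (1 / 2) * deriv V (w x) * deriv w x * φ x * e1
  rw [integral_congr_ae key, integral_add hFi (by fun_prop), hF0, integral_add (by fun_prop)
    (by fun_prop), integral_add (by fun_prop) (by fun_prop), integral_neg, integral_const_mul,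
    integral_const_mul, zero_add]

/-- intermediate integration-by-parts identity in the proof of
Theorem 4.4. -/
theorem integration_by_parts_identity
    (T : ℝ) (hT : 0 < T) (η : ℝ) (hη : 0 < η)
    (V : ℝ → ℝ) (hV : ContDiff ℝ 1 V) (hVmono : Monotone V)
    (q : ℝ → ℝ → ℝ)
    (hq : IsStrongSolutionNonlocal T V (expKernel η) (fun x => q 0 x) q)
    (G : ℝ → ℝ) (hG : ∀ y : ℝ, G y = ∫ s in (0:ℝ)..y, s * V s) :
    ∀ φ : ℝ → ℝ → ℝ, IsTestFun T φ →
      ((∫ t in Ioo (0:ℝ) T, ∫ x : ℝ,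
          deriv (fun y => q t y) x *
            (V |q t x| - V (nonlocalTerm (expKernel η) q t x)) * q t x * φ t x) =
        -(∫ t in Ioo (0:ℝ) T, ∫ x : ℝ,
            (G |q t x| - G (nonlocalTerm (expKernel η) q t x)) *
              deriv (fun y => φ t y) x)
        + (1 / 2) * (∫ t in Ioo (0:ℝ) T, ∫ x : ℝ,
            (q t x ^ 2 - nonlocalTerm (expKernel η) q t x ^ 2) *
              V (nonlocalTerm (expKernel η) q t x) * deriv (fun y => φ t y) x)
        + η * (∫ t in Ioo (0:ℝ) T, ∫ x : ℝ,
            deriv V (nonlocalTerm (expKernel η) q t x) *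
              (deriv (fun y => nonlocalTerm (expKernel η) q t y) x) ^ 2 *
              (nonlocalTerm (expKernel η) q t x +
                (η / 2) * deriv (fun y => nonlocalTerm (expKernel η) q t y) x) *
              φ t x)) ∧
      ((∀ t x : ℝ, 0 ≤ φ t x) →
        0 ≤ η * (∫ t in Ioo (0:ℝ) T, ∫ x : ℝ,
            deriv V (nonlocalTerm (expKernel η) q t x) *
              (deriv (fun y => nonlocalTerm (expKernel η) q t y) x) ^ 2 *
              (nonlocalTerm (expKernel η) q t x +
                (η / 2) * deriv (fun y => nonlocalTerm (expKernel η) q t y) x) *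
              φ t x)) := by
  obtain ⟨⟨L, hL⟩, -, -⟩ := hq
  have hVc : Continuous V := hV.continuous
  have hV'c : Continuous (deriv V) := hV.continuous_deriv le_rfl
  have hGc : Continuous G := by
    rw [show G = _ from funext hG]
    exact (contDiff_primitive (f := fun s => s * V s) (by fun_prop)).continuous
  -- Extend `q` from the time strip to all times by clamping the time variable.
  obtain ⟨p, hp⟩ : ∃ p : ℝ → ℝ → ℝ, p = fun t x => q (max 0 (min t T)) x := ⟨_, rfl⟩
  have hclamp : ∀ t : ℝ, max 0 (min t T) ∈ Icc (0 : ℝ) T := fun t =>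
    ⟨le_max_left _ _, max_le hT.le (min_le_right _ _)⟩
  have hpq : ∀ t ∈ Ioo (0 : ℝ) T, p t = q t := fun t ht => by
    rw [hp]
    simp only [min_eq_left ht.2.le, max_eq_right ht.1.le]
  have hpc : Continuous (uncurry p) := by
    rw [hp]
    exact hL.continuousOn.comp_continuous
      (f := fun z : ℝ × ℝ => (max 0 (min z.1 T), z.2)) (by fun_prop)
      fun z => ⟨hclamp z.1, mem_univ _⟩
  have hpL : ∀ t, LipschitzWith L (p t) := fun t => by
    refine LipschitzWith.of_dist_le_mul fun x y => ?_
    have h := hL.dist_le_mul (max 0 (min t T), x) ⟨hclamp t, mem_univ _⟩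
      (max 0 (min t T), y) ⟨hclamp t, mem_univ _⟩
    rw [Prod.dist_eq, dist_self, max_eq_right dist_nonneg] at h
    rw [hp]
    exact h
  have hpb : ∀ t y, |p t y| ≤ (|q 0 0| + L * T) + L * |y| := fun t y => by
    have h := hL.dist_le_mul (max 0 (min t T), y) ⟨hclamp t, mem_univ _⟩
      (0, 0) ⟨⟨le_rfl, hT.le⟩, mem_univ _⟩
    have h1 : dist (max 0 (min t T), y) ((0 : ℝ), (0 : ℝ)) ≤ T + |y| := by
      rw [Prod.dist_eq, Real.dist_0_eq_abs, Real.dist_0_eq_abs, abs_of_nonneg (hclamp t).1]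
      exact max_le (by linarith [(hclamp t).2, abs_nonneg y]) (by linarith)
    have h2 := h.trans (mul_le_mul_of_nonneg_left h1 L.coe_nonneg)
    rw [Real.dist_eq] at h2
    have h3 := abs_sub_abs_le_abs_sub (p t y) (q 0 0)
    rw [hp] at h3 ⊢
    simp only [uncurry] at h2 h3 ⊢
    linarith
  obtain ⟨W, hWdef⟩ : ∃ W, W = nonlocalTerm (expKernel η) p := ⟨_, rfl⟩
  have hWq : ∀ t ∈ Ioo (0 : ℝ) T, nonlocalTerm (expKernel η) q t = W t := fun t ht => by
    ext x
    rw [hWdef, nonlocalTerm, nonlocalTerm, hpq t ht]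
  have hWd : ∀ t x, HasDerivAt (W t) ((|p t x| - W t x) / η) x := fun t x => by
    rw [hWdef]
    exact hasDerivAt_nonlocalTerm_expKernel hη (hpL t).continuous (hpb t) x
  have hWc : Continuous (uncurry W) := by
    rw [hWdef]
    exact continuous_nonlocalTerm_expKernel hη hpc hpb
  have hW0 : ∀ t x, 0 ≤ W t x := fun t x => by
    rw [hWdef]
    exact nonlocalTerm_expKernel_nonneg hη p t x
  have hWdc : Continuous fun z : ℝ × ℝ => deriv (W z.1) z.2 := by
    simp only [(hWd _ _).deriv]
    exact (hpc.abs.sub hWc).div_const η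
  intro φ hφ
  have hφt : ∀ t, ContDiff ℝ 1 (φ t) := fun t => hφ.smooth.comp (contDiff_prodMk_right t)
  have hφd : ∀ z : ℝ × ℝ, deriv (φ z.1) z.2 = fderiv ℝ (uncurry φ) z (0, 1) := fun z => by
    have h1 := (hφ.smooth.differentiable one_ne_zero z).hasFDerivAt
    exact (h1.comp_hasDerivAt z.2 ((hasDerivAt_const z.2 z.1).prodMk (hasDerivAt_id z.2))).deriv
  have hφ'c : Continuous fun z : ℝ × ℝ => deriv (φ z.1) z.2 := by
    simp only [hφd]
    exact (hφ.smooth.continuous_fderiv one_ne_zero).clm_apply continuous_const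
  have hφ's : HasCompactSupport fun z : ℝ × ℝ => deriv (φ z.1) z.2 := by
    simp only [hφd]
    exact hφ.compSupp.fderiv_apply ℝ (0, 1)
  have hφts : ∀ t, HasCompactSupport (φ t) := fun t =>
    hφ.compSupp.comp_isClosedEmbedding (.of_continuous_injective_isClosedMap
      (Continuous.prodMk_right t) (Prod.mk_right_injective t) (isClosedMap_prodMk_left t))
  have hpc' : Continuous fun z : ℝ × ℝ => p z.1 z.2 := hpc
  have hWc' : Continuous fun z : ℝ × ℝ => W z.1 z.2 := hWc
  have iA : Integrable fun t => ∫ x, (G |p t x| - G (W t x)) * deriv (φ t) x :=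
    (integrable_mul_of_hasCompactSupport (μ := volume.prod volume)
      (g := fun z : ℝ × ℝ => G |p z.1 z.2| - G (W z.1 z.2)) (by fun_prop)
      hφ'c hφ's).integral_prod_left
  have iB : Integrable fun t => ∫ x, (p t x ^ 2 - W t x ^ 2) * V (W t x) * deriv (φ t) x :=
    (integrable_mul_of_hasCompactSupport (μ := volume.prod volume)
      (g := fun z : ℝ × ℝ => (p z.1 z.2 ^ 2 - W z.1 z.2 ^ 2) * V (W z.1 z.2)) (by fun_prop)
      hφ'c hφ's).integral_prod_left
  have iC : Integrable fun t => ∫ x, deriv V (W t x) * deriv (W t) x ^ 2 *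
      (W t x + (η / 2) * deriv (W t) x) * φ t x :=
    (integrable_mul_of_hasCompactSupport (μ := volume.prod volume)
      (g := fun z : ℝ × ℝ => deriv V (W z.1 z.2) * deriv (W z.1) z.2 ^ 2 *
        (W z.1 z.2 + (η / 2) * deriv (W z.1) z.2)) (by fun_prop)
      hφ.smooth.continuous hφ.compSupp).integral_prod_left
  have toP : ∀ Q : (ℝ → ℝ) → (ℝ → ℝ) → (ℝ → ℝ) → ℝ,
      ∫ t in Ioo (0 : ℝ) T, Q (q t) (nonlocalTerm (expKernel η) q t) (φ t) =
        ∫ t in Ioo (0 : ℝ) T, Q (p t) (W t) (φ t) := fun Q =>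
    setIntegral_congr_fun measurableSet_Ioo fun t ht => by
      simp only [hWq t ht, hpq t ht]
  have eC := toP fun f w ψ => ∫ x, deriv V (w x) * deriv w x ^ 2 *
    (w x + (η / 2) * deriv w x) * ψ x
  refine ⟨?_, fun hφ0 => ?_⟩
  · have eL := toP fun f w ψ => ∫ x, deriv f x * (V |f x| - V (w x)) * f x * ψ x
    have eA := toP fun f w ψ => ∫ x, (G |f x| - G (w x)) * deriv ψ x
    have eB := toP fun f w ψ => ∫ x, (f x ^ 2 - w x ^ 2) * V (w x) * deriv ψ x
    refine eL.trans ?_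
    refine Eq.trans ?_ (congrArg₂ (· + ·) (congrArg₂ (· + ·) (congrArg Neg.neg eA)
      (congrArg ((1 / 2) * ·) eB)) (congrArg (η * ·) eC)).symm
    simp only [integral_slice_identity hη hV hG (hpL _) (hWd _) (hφt _) (hφts _)]
    have iA' := iA.fun_neg.restrict (s := Ioo (0 : ℝ) T)
    have iB' := (iB.const_mul (1 / 2)).restrict (s := Ioo (0 : ℝ) T)
    have iC' := (iC.const_mul η).restrict (s := Ioo (0 : ℝ) T)
    rw [integral_add (iA'.fun_add iB') iC', integral_add iA' iB',
      integral_neg, integral_const_mul, integral_const_mul]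
  · refine mul_nonneg hη.le (eC.symm ▸ ?_)
    refine integral_nonneg fun t => integral_nonneg fun x => ?_
    have h1 : W t x + (η / 2) * deriv (W t) x = (W t x + |p t x|) / 2 := by
      rw [(hWd t x).deriv]
      field_simp
      ring
    have h2 := hW0 t x
    have h3 := hVmono.deriv_nonneg (x := W t x)
    have h4 := hφ0 t x
    simp only [Pi.zero_apply, h1]
    positivity

end
end

section
/- (Conservation of the L¹-norm.) Let T > 0, η > 0, let V : ℝ → ℝ be locally Lipschitz and nondecreasing, and let q ∈ W^{1,∞}(Ω_T) be a strong solution of the nonlocal conservation law ∂_t q + ∂_x(V(W[q,γ_η])q) = 0 with exponential kernel γ_η such that q(t,·) ∈ L¹(ℝ) for every t ∈ [0,T]. Then the L¹-norm is conserved: ∫_ℝ |q(t,x)| dx = ∫_ℝ |q(0,x)| dx for every t ∈ [0,T]. -/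
open MeasureTheory Set Filter Function

noncomputable section

open scoped Topology NNReal

/-- A Lipschitz function is controlled by its local averages. -/
lemma LipschitzWith.mul_abs_le_integral_add {f : ℝ → ℝ} {K : ℝ≥0} (hf : LipschitzWith K f)
    (x : ℝ) {δ : ℝ} (hδ : 0 < δ) :
    δ * |f x| ≤ (∫ y in x..x + δ, |f y|) + K * δ ^ 2 := by
  have hle : (∫ _y in x..x + δ, (|f x| - K * δ)) ≤ ∫ y in x..x + δ, |f y| := by
    refine intervalIntegral.integral_mono_on (by linarith) (by simp)
      (hf.continuous.abs.intervalIntegrable _ _) fun y hy => ?_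
    have h1 : |f x - f y| ≤ K * |x - y| := by
      simpa [Real.dist_eq] using hf.dist_le_mul x y
    have h2 : |x - y| ≤ δ := by
      rw [abs_le]; constructor <;> linarith [hy.1, hy.2]
    have h3 : (K : ℝ) * |x - y| ≤ K * δ := by gcongr
    linarith [abs_sub_abs_le_abs_sub (f x) (f y)]
  rw [intervalIntegral.integral_const, smul_eq_mul] at hle
  nlinarith

/-- An integrable Lipschitz function is bounded. -/
lemma LipschitzWith.abs_le_of_integrable {f : ℝ → ℝ} {K : ℝ≥0} (hf : LipschitzWith K f)
    (hi : Integrable f) (x : ℝ) : |f x| ≤ (∫ y, |f y|) + K := by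
  have h := hf.mul_abs_le_integral_add x one_pos
  have h2 : (∫ y in x..x + 1, |f y|) ≤ ∫ y, |f y| := by
    rw [intervalIntegral.integral_of_le (by linarith)]
    exact setIntegral_le_integral hi.abs (.of_forall fun y => abs_nonneg _)
  linarith

/-- An integrable Lipschitz function vanishes at `+∞`. -/
lemma LipschitzWith.tendsto_zero_atTop_of_integrable {f : ℝ → ℝ} {K : ℝ≥0}
    (hf : LipschitzWith K f) (hi : Integrable f) : Tendsto f atTop (𝓝 0) := by
  rw [tendsto_zero_iff_abs_tendsto_zero, Metric.tendsto_nhds]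
  intro ε hε
  obtain ⟨δ, hδ, hKδ⟩ : ∃ δ : ℝ, 0 < δ ∧ K * δ < ε / 2 := by
    refine ⟨ε / (2 * (K + 1)), by positivity, ?_⟩
    rw [mul_div_assoc', div_lt_div_iff₀ (by positivity) (by positivity)]
    nlinarith [K.coe_nonneg]
  have hlim : Tendsto (fun x => ∫ y in x..x + δ, |f y|) atTop (𝓝 0) := by
    have h0 : Tendsto (fun x => ∫ y in (0 : ℝ)..x, |f y|) atTop (𝓝 (∫ y in Ioi 0, |f y|)) :=
      intervalIntegral_tendsto_integral_Ioi 0 hi.abs.integrableOn tendsto_id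
    have h1 := (h0.comp (tendsto_atTop_add_const_right atTop δ tendsto_id)).sub h0
    rw [sub_self] at h1
    refine h1.congr fun x => ?_
    exact intervalIntegral.integral_interval_sub_left
      (hf.continuous.abs.intervalIntegrable _ _) (hf.continuous.abs.intervalIntegrable _ _)
  have hev := hlim.eventually (gt_mem_nhds (show 0 < δ * (ε / 2) by positivity))
  filter_upwards [hev] with x hx
  have h := hf.mul_abs_le_integral_add x hδ
  have h2 : δ * |f x| < δ * ε := by nlinarith
  simpa using lt_of_mul_lt_mul_left h2 hδ.le

/-- An integrable Lipschitz function vanishes at `-∞`. -/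
lemma LipschitzWith.tendsto_zero_atBot_of_integrable {f : ℝ → ℝ} {K : ℝ≥0}
    (hf : LipschitzWith K f) (hi : Integrable f) : Tendsto f atBot (𝓝 0) := by
  have hneg : LipschitzWith K (fun x => f (-x)) := by
    simpa [Function.comp_def] using hf.comp (isometry_neg (G := ℝ)).lipschitz
  simpa [Function.comp_def] using
    (hneg.tendsto_zero_atTop_of_integrable hi.comp_neg).comp tendsto_neg_atBot_atTop

lemma expKernel_nonneg {η : ℝ} (hη : 0 < η) (x : ℝ) : 0 ≤ expKernel η x := by
  unfold expKernel; positivity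

lemma expKernel_eq_exp_inv_mul (η : ℝ) : expKernel η = fun x => Real.exp (η⁻¹ * x) / η := by
  ext x
  rw [expKernel, div_eq_inv_mul x η]

lemma integrableOn_expKernel {η : ℝ} (hη : 0 < η) : IntegrableOn (expKernel η) (Iic 0) := by
  rw [expKernel_eq_exp_inv_mul]
  exact (integrableOn_exp_mul_Iic (inv_pos.2 hη) 0).div_const η

lemma integral_expKernel {η : ℝ} (hη : 0 < η) : ∫ x in Iic 0, expKernel η x = 1 := by
  rw [expKernel_eq_exp_inv_mul, integral_div, integral_exp_mul_Iic (inv_pos.2 hη)]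
  simp [hη.ne']

/-- The nonlocal term as an integral over a fixed domain. -/
lemma nonlocalTerm_eq_integral_Iic_zero (γ : ℝ → ℝ) (q : ℝ → ℝ → ℝ) (t x : ℝ) :
    nonlocalTerm γ q t x = ∫ z in Iic (0 : ℝ), γ z * |q t (z + x)| := by
  unfold nonlocalTerm
  rw [← integral_indicator measurableSet_Iic, ← integral_indicator measurableSet_Iic,
    ← integral_add_right_eq_self _ x]
  refine integral_congr_ae (.of_forall fun z => ?_)
  simp [indicator_apply]

section nonlocalTerm

variable {η M : ℝ} {q : ℝ → ℝ → ℝ} {t : ℝ} {L : ℝ≥0}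

lemma integrableOn_expKernel_mul (hη : 0 < η) (hL : LipschitzWith L (q t))
    (hM : ∀ x, |q t x| ≤ M) (x : ℝ) :
    IntegrableOn (fun z => expKernel η z * |q t (z + x)|) (Iic 0) := by
  refine (integrableOn_expKernel hη).mul_bdd (c := M) ?_ (.of_forall fun z => by simpa using hM _)
  exact (hL.continuous.comp (continuous_id.add continuous_const)).abs.aestronglyMeasurable

lemma nonlocalTerm_mem_Icc (hη : 0 < η) (hL : LipschitzWith L (q t))
    (hM : ∀ x, |q t x| ≤ M) (x : ℝ) : nonlocalTerm (expKernel η) q t x ∈ Icc 0 M := by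
  rw [nonlocalTerm_eq_integral_Iic_zero]
  constructor
  · exact integral_nonneg fun z => mul_nonneg (expKernel_nonneg hη _) (abs_nonneg _)
  · calc _ ≤ ∫ z in Iic (0 : ℝ), expKernel η z * M :=
          integral_mono (integrableOn_expKernel_mul hη hL hM x)
            ((integrableOn_expKernel hη).mul_const M)
            fun z => mul_le_mul_of_nonneg_left (hM _) (expKernel_nonneg hη _)
      _ = M := by rw [integral_mul_const, integral_expKernel hη, one_mul]

lemma lipschitzWith_nonlocalTerm (hη : 0 < η) (hL : LipschitzWith L (q t))
    (hM : ∀ x, |q t x| ≤ M) : LipschitzWith L (nonlocalTerm (expKernel η) q t) := by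
  refine LipschitzWith.of_dist_le_mul fun x y => ?_
  rw [Real.dist_eq, nonlocalTerm_eq_integral_Iic_zero, nonlocalTerm_eq_integral_Iic_zero,
    ← integral_sub (integrableOn_expKernel_mul hη hL hM x)
      (integrableOn_expKernel_mul hη hL hM y), ← Real.norm_eq_abs]
  calc _ ≤ ∫ z in Iic (0 : ℝ), expKernel η z * (L * dist x y) := by
        refine norm_integral_le_of_norm_le ((integrableOn_expKernel hη).mul_const _)
          (.of_forall fun z => ?_)
        rw [← mul_sub, norm_mul, Real.norm_of_nonneg (expKernel_nonneg hη z)]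
        refine mul_le_mul_of_nonneg_left ?_ (expKernel_nonneg hη z)
        have h := hL.dist_le_mul (z + x) (z + y)
        rw [dist_add_left] at h
        exact (abs_abs_sub_abs_le_abs_sub _ _).trans h
    _ = L * dist x y := by rw [integral_mul_const, integral_expKernel hη, one_mul]

end nonlocalTerm

/-- Pointwise renormalization of a balance law by the absolute value. -/
lemma deriv_abs_add_deriv_mul_abs_eq_zero {a b v : ℝ → ℝ} {s x : ℝ} (ha : ContinuousAt a s)
    (hb : ContinuousAt b x) (hab : a s = b x) (hv : DifferentiableAt ℝ v x)
    (hb' : DifferentiableAt ℝ (fun y => |b y|) x)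
    (h : deriv a s + deriv (fun y => v y * b y) x = 0) :
    deriv (fun τ => |a τ|) s + deriv (fun y => v y * |b y|) x = 0 := by
  rcases lt_trichotomy (b x) 0 with hx | hx | hx
  · have h1 : (fun τ => |a τ|) =ᶠ[𝓝 s] fun τ => -a τ := by
      filter_upwards [ha.eventually (gt_mem_nhds (hab ▸ hx))] with τ hτ
      exact abs_of_neg hτ
    have h2 : (fun y => v y * |b y|) =ᶠ[𝓝 x] fun y => -(v y * b y) := by
      filter_upwards [hb.eventually (gt_mem_nhds hx)] with y hy
      rw [abs_of_neg hy, mul_neg]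
    rw [h1.deriv_eq, h2.deriv_eq, deriv.fun_neg, deriv.fun_neg]
    linarith
  · have h1 : deriv (fun τ => |a τ|) s = 0 := by
      refine IsLocalMin.deriv_eq_zero (.of_forall fun τ => ?_)
      simp [hab, hx]
    have h2 : deriv (fun y => |b y|) x = 0 := by
      refine IsLocalMin.deriv_eq_zero (.of_forall fun y => ?_)
      simp [hx]
    rw [deriv_fun_mul hv hb', h1, h2, hx]
    simp
  · have h1 : (fun τ => |a τ|) =ᶠ[𝓝 s] a := by
      filter_upwards [ha.eventually (lt_mem_nhds (hab ▸ hx))] with τ hτ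
      exact abs_of_pos hτ
    have h2 : (fun y => v y * |b y|) =ᶠ[𝓝 x] fun y => v y * b y := by
      filter_upwards [hb.eventually (lt_mem_nhds hx)] with y hy
      rw [abs_of_pos hy]
    rw [h1.deriv_eq, h2.deriv_eq, h]

/-- The absolute value of the density changes on an interval only through the boundary flux. -/
lemma integral_deriv_abs_eq_flux {Q : ℝ × ℝ → ℝ} {v : ℝ → ℝ} {L K : ℝ≥0} {s : ℝ}
    (hQ : LipschitzWith L Q) (hv : LipschitzWith K v)
    (h : ∀ᵐ x, deriv (fun τ => Q (τ, x)) s + deriv (fun y => v y * Q (s, y)) x = 0) (a b : ℝ) :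
    ∫ x in a..b, deriv (fun τ => |Q (τ, x)|) s = v a * |Q (s, a)| - v b * |Q (s, b)| := by
  have hb : LipschitzWith L (fun y => |Q (s, y)|) := by
    simpa [Function.comp_def] using (lipschitzWith_one_norm (E := ℝ)).comp (hQ.comp (LipschitzWith.prodMk_left s))
  have hac := (hv.lipschitzOnWith (s := uIcc a b)).absolutelyContinuousOnInterval.fun_mul
    (hb.lipschitzOnWith (s := uIcc a b)).absolutelyContinuousOnInterval
  rw [← neg_sub, ← hac.integral_deriv_eq_sub, ← intervalIntegral.integral_neg]
  refine intervalIntegral.integral_congr_ae ?_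
  filter_upwards [h, hv.ae_differentiableAt_real, hb.ae_differentiableAt_real] with x hx hvx hbx _
  have hc := hQ.continuous
  exact eq_neg_of_add_eq_zero_left <| deriv_abs_add_deriv_mul_abs_eq_zero
    (a := fun τ => Q (τ, x)) (b := fun y => Q (s, y))
    (by fun_prop) (by fun_prop) rfl hvx hbx hx

/-- The spatial integral of a Lipschitz density evolves by the integral of its time derivative. -/
lemma integral_sub_eq_integral_integral_deriv {u : ℝ × ℝ → ℝ} {L : ℝ≥0} (hu : LipschitzWith L u)
    (t a b : ℝ) :
    AEStronglyMeasurable (fun s => ∫ x in a..b, deriv (fun τ => u (τ, x)) s) ∧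
    (∫ x in a..b, u (t, x)) - (∫ x in a..b, u (0, x)) =
      ∫ s in (0 : ℝ)..t, ∫ x in a..b, deriv (fun τ => u (τ, x)) s := by
  have hc := hu.continuous
  have hux : ∀ x, LipschitzWith L fun τ => u (τ, x) := fun x => by
    simpa [Function.comp_def] using hu.comp (LipschitzWith.prodMk_right x)
  have hmeas : Measurable (fun p : ℝ × ℝ => deriv (fun τ => u (τ, p.2)) p.1) :=
    (measurable_deriv_with_param (f := fun x τ => u (τ, x))
      (by simp only [uncurry_def]; fun_prop)).comp measurable_swap
  constructor
  · simp only [intervalIntegral]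
    exact ((hmeas.stronglyMeasurable.integral_prod_right (ν := volume.restrict (Ioc a b))).sub
      (hmeas.stronglyMeasurable.integral_prod_right
        (ν := volume.restrict (Ioc b a)))).aestronglyMeasurable
  · rw [intervalIntegral_intervalIntegral_swap,
      ← intervalIntegral.integral_sub
        (Continuous.intervalIntegrable (by fun_prop) _ _)
        (Continuous.intervalIntegrable (by fun_prop) _ _)]
    · refine intervalIntegral.integral_congr fun x _ => ?_
      exact (((hux x).lipschitzOnWith
        (s := uIcc 0 t)).absolutelyContinuousOnInterval.integral_deriv_eq_sub).symm
    · refine Measure.integrableOn_of_bounded (M := L) ?_ hmeas.aestronglyMeasurable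
        (.of_forall fun p => ?_)
      · rw [Measure.volume_eq_prod, Measure.prod_prod]
        simp [uIoc, ENNReal.mul_eq_top]
      · exact norm_deriv_le_of_lipschitz (hux p.2)

/-- conservation of the L¹-norm for strong solutions of the
nonlocal conservation law with exponential kernel. -/
theorem L1_norm_conservation
    (T : ℝ) (hT : 0 < T) (η : ℝ) (hη : 0 < η)
    (V : ℝ → ℝ) (hV : LocallyLipschitz V) (hVmono : Monotone V)
    (q : ℝ → ℝ → ℝ)
    (hq : IsStrongSolutionNonlocal T V (expKernel η) (fun x => q 0 x) q)
    (hqL1 : ∀ t ∈ Icc (0:ℝ) T, Integrable (q t) volume) :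
    ∀ t ∈ Icc (0:ℝ) T, (∫ x : ℝ, |q t x|) = ∫ x : ℝ, |q 0 x| := by
  intro t ht
  obtain ⟨⟨L, hL⟩, -, hpde⟩ := hq
  obtain ⟨Q, hQ, hqQ⟩ := hL.extend_real
  have hQq : ∀ s ∈ Icc 0 T, ∀ x, q s x = Q (s, x) := fun s hs x => hqQ (mk_mem_prod hs (mem_univ x))
  have h0 : (0 : ℝ) ∈ Icc 0 T := ⟨le_rfl, hT.le⟩
  have hqx : ∀ s ∈ Icc 0 T, LipschitzWith L (q s) := fun s hs => by
    rw [show q s = fun x => Q (s, x) from funext (hQq s hs)]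
    simpa [Function.comp_def] using hQ.comp (LipschitzWith.prodMk_left s)
  obtain ⟨M, hM⟩ : ∃ M, ∀ s ∈ Icc 0 T, ∀ x, |q s x| ≤ M := by
    refine ⟨(∫ y, |q 0 y|) + L + L * T, fun s hs x => ?_⟩
    have h1 := (hqx 0 h0).abs_le_of_integrable (hqL1 0 h0) x
    have h2 : |q s x - q 0 x| ≤ L * |s| := by
      have := hQ.dist_le_mul (s, x) (0, x)
      rw [hQq s hs, hQq 0 h0]
      simpa [Real.dist_eq, Prod.dist_eq] using this
    rw [abs_of_nonneg hs.1] at h2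
    have h3 : (L : ℝ) * s ≤ L * T := by gcongr; exact hs.2
    linarith [abs_sub_abs_le_abs_sub (q s x) (q 0 x)]
  obtain ⟨K, hK⟩ := (hV.locallyLipschitzOn (s := Icc 0 M)).exists_lipschitzOnWith_of_compact
    isCompact_Icc
  obtain ⟨C, hC⟩ := (isCompact_Icc (a := 0) (b := M)).exists_bound_of_continuousOn
    hV.continuous.continuousOn
  set v : ℝ → ℝ → ℝ := fun s x => V (nonlocalTerm (expKernel η) q s x) with hvdef
  have hvLip : ∀ s ∈ Icc 0 T, LipschitzWith (K * L) (v s) := fun s hs => by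
    rw [← lipschitzOnWith_univ]
    exact hK.comp (lipschitzWith_nonlocalTerm hη (hqx s hs) (hM s hs)).lipschitzOnWith
      fun x _ => nonlocalTerm_mem_Icc hη (hqx s hs) (hM s hs) x
  have hvC : ∀ s ∈ Icc 0 T, ∀ x, |v s x| ≤ C := fun s hs x =>
    hC _ (nonlocalTerm_mem_Icc hη (hqx s hs) (hM s hs) x)
  have hpde' : ∀ᵐ s, s ∈ Ioo 0 T →
      ∀ᵐ x, deriv (fun τ => Q (τ, x)) s + deriv (fun y => v s y * Q (s, y)) x = 0 := by
    rw [Measure.volume_eq_prod, ← Measure.prod_restrict, Measure.restrict_univ] at hpde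
    rw [← ae_restrict_iff' measurableSet_Ioo]
    filter_upwards [Measure.ae_ae_of_ae_prod hpde, ae_restrict_mem measurableSet_Ioo] with s hs hsT
    filter_upwards [hs] with x hx
    have h1 : (fun τ => q τ x) =ᶠ[𝓝 s] fun τ => Q (τ, x) := by
      filter_upwards [Icc_mem_nhds hsT.1 hsT.2] with τ hτ using hQq τ hτ x
    simpa only [h1.deriv_eq, hvdef, hQq s (Ioo_subset_Icc_self hsT)] using hx
  have hflux : ∀ᵐ s, s ∈ uIoc 0 t → s ∈ Icc 0 T ∧ ∀ a b,
      ∫ x in a..b, deriv (fun τ => |Q (τ, x)|) s = v s a * |q s a| - v s b * |q s b| := by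
    have hne : ∀ᵐ s : ℝ, s ≠ T := by simp [ae_iff]
    filter_upwards [hpde', hne] with s hs hsT hst
    rw [uIoc_of_le ht.1] at hst
    have hmem : s ∈ Ioo 0 T := ⟨hst.1, lt_of_le_of_ne (hst.2.trans ht.2) hsT⟩
    have hs' := Ioo_subset_Icc_self hmem
    refine ⟨hs', fun a b => ?_⟩
    rw [integral_deriv_abs_eq_flux hQ (hvLip s hs') (hs hmem), hQq s hs', hQq s hs']
  have huLip : LipschitzWith L (fun p => |Q p|) := by
    simpa [Function.comp_def] using (lipschitzWith_one_norm (E := ℝ)).comp hQ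
  have hbound : ∀ s ∈ Icc 0 T, ∀ x, |v s x * (|q s x|)| ≤ C * M := fun s hs x => by
    rw [abs_mul, abs_abs]
    exact mul_le_mul (hvC s hs x) (hM s hs x) (abs_nonneg _) ((abs_nonneg _).trans (hvC s hs x))
  have hvanish : ∀ s ∈ Icc 0 T, ∀ l : Filter ℝ, Tendsto (q s) l (𝓝 0) →
      Tendsto (fun x => v s x * |q s x|) l (𝓝 0) := fun s hs l hl => by
    refine squeeze_zero_norm (a := fun x => C * |q s x|) (fun x => ?_)
      (by simpa using hl.abs.const_mul C)
    rw [norm_mul, Real.norm_eq_abs, Real.norm_eq_abs, abs_abs]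
    exact mul_le_mul_of_nonneg_right (hvC s hs x) (abs_nonneg _)
  have hlim : Tendsto (fun R : ℝ => ∫ s in (0 : ℝ)..t,
      ∫ x in -R..R, deriv (fun τ => |Q (τ, x)|) s) atTop (𝓝 (∫ _s in (0 : ℝ)..t, (0 : ℝ))) := by
    refine intervalIntegral.tendsto_integral_filter_of_dominated_convergence
      (fun _ => C * M + C * M) (.of_forall fun R => ?_) (.of_forall fun R => ?_) (by simp) ?_
    · exact (integral_sub_eq_integral_integral_deriv huLip t (-R) R).1.restrict
    · filter_upwards [hflux] with s hs hst
      obtain ⟨hsT, h⟩ := hs hst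
      rw [h]
      exact (norm_sub_le _ _).trans (add_le_add (hbound s hsT _) (hbound s hsT _))
    · filter_upwards [hflux] with s hs hst
      obtain ⟨hsT, h⟩ := hs hst
      simp_rw [h]
      have h1 := hvanish s hsT _ ((hqx s hsT).tendsto_zero_atTop_of_integrable (hqL1 s hsT))
      have h2 := hvanish s hsT _ ((hqx s hsT).tendsto_zero_atBot_of_integrable (hqL1 s hsT))
      simpa using (h2.comp tendsto_neg_atTop_atBot).sub h1
  have hL1lim : ∀ s ∈ Icc 0 T,
      Tendsto (fun R : ℝ => ∫ x in -R..R, |Q (s, x)|) atTop (𝓝 (∫ x, |q s x|)) := fun s hs => by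
    simp_rw [← hQq s hs]
    exact intervalIntegral_tendsto_integral (hqL1 s hs).abs tendsto_neg_atTop_atBot tendsto_id
  have hdiff := (hL1lim t ht).sub (hL1lim 0 h0)
  simp_rw [(integral_sub_eq_integral_integral_deriv huLip t _ _).2] at hdiff
  rw [intervalIntegral.integral_zero] at hlim
  exact sub_eq_zero.1 (tendsto_nhds_unique hdiff hlim)

end
end
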